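/- Under the hypotheses of Theorem 1 (ρ satisfying condition (3) with S = 0, f ∈ H^{1,2}(Δ)ⁿ ∩ C⁴(Γ)ⁿ with ρ(z,f(z)) = 1 on Γ and the complex tangent planes to the fibers as stated), the function z ↦ Σⱼ₌₁ⁿ fⱼ(z) ∂ρ/∂wⱼ(z, f(z)) is nonvanishing on Γ and has winding number zero. -/

import Mathlib

open Complex Metric MeasureTheory Filter Set

noncomputable section

/-- The unit circle `Γ` in `ℂ`. -/
def Circ : Set ℂ := Metric.sphere (0 : ℂ) 1

/-- The closed unit disk `Δ` in `ℂ`. -/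
def Disk : Set ℂ := Metric.closedBall (0 : ℂ) 1

/-- The Euclidean norm on `ℂⁿ`. -/
def euclNorm {n : ℕ} (w : Fin n → ℂ) : ℝ := Real.sqrt (∑ j, Complex.normSq (w j))

/-- The complex partial derivative `∂g/∂wⱼ` of a real-valued function `g` on `ℂⁿ`. -/
def wderiv {n : ℕ} (g : (Fin n → ℂ) → ℝ) (w : Fin n → ℂ) (j : Fin n) : ℂ :=
  (((fderiv ℝ g w) (Pi.single j 1) : ℝ) - Complex.I * ((fderiv ℝ g w) (Pi.single j Complex.I) : ℝ)) / 2

/-- The affine complex tangent plane at `p` to the level set of `g` through `p`. -/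
def TangentPlane {n : ℕ} (g : (Fin n → ℂ) → ℝ) (p : Fin n → ℂ) : Set (Fin n → ℂ) :=
  {w | ∑ j, (w j - p j) * wderiv g p j = 0}

/-- `ρ` is strictly hypoconvex on a subset `U` of `Γ × ℂⁿ`: on every compact subset
there is `𝒦 > 0` such that the real Hessian in `w` is `≥ 𝒦‖u‖²` on complex tangent
vectors `u` of the fibers. -/
def StrictHypoconvexOn {n : ℕ} (ρ : ℂ → (Fin n → ℂ) → ℝ) (U : Set (ℂ × (Fin n → ℂ))) : Prop :=
  ∀ C : Set (ℂ × (Fin n → ℂ)), C ⊆ U → IsCompact C →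
    ∃ K0 > (0:ℝ), ∀ p ∈ C, ∀ u : Fin n → ℂ,
      (∑ j, u j * wderiv (ρ p.1) p.2 j) = 0 →
      K0 * (euclNorm u)^2 ≤ iteratedFDeriv ℝ 2 (ρ p.1) p.2 ![u, u]

/-- Two subsets of real normed spaces are (C⁶-)diffeomorphic: there are C⁶ maps on
open neighborhoods carrying one onto the other, inverse to each other on the sets. -/
def DiffeomorphicSets {E F : Type*} [NormedAddCommGroup E] [NormedSpace ℝ E]
    [NormedAddCommGroup F] [NormedSpace ℝ F] (A : Set E) (B : Set F) : Prop :=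
  ∃ (U : Set E) (V : Set F) (f : E → F) (g : F → E),
    IsOpen U ∧ IsOpen V ∧ A ⊆ U ∧ B ⊆ V ∧
    ContDiffOn ℝ 6 f U ∧ ContDiffOn ℝ 6 g V ∧
    Set.MapsTo f A B ∧ Set.MapsTo g B A ∧
    (∀ x ∈ A, g (f x) = x) ∧ (∀ y ∈ B, f (g y) = y)

/-- Condition (3) of the paper, for `ρ` with respect to `R` and `S`. -/
structure Cond3 (n : ℕ) (ρ : ℂ → (Fin n → ℂ) → ℝ) (R : ℝ) (S : ℂ → Fin n → ℂ) : Prop where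
  hn : 2 ≤ n
  nonneg : ∀ z ∈ Circ, ∀ w, 0 ≤ ρ z w
  cont : ContinuousOn (fun p : ℂ × (Fin n → ℂ) => ρ p.1 p.2) {p | p.1 ∈ Circ}
  smooth : ContDiffOn ℝ 6 (fun p : ℂ × (Fin n → ℂ) => ρ p.1 p.2)
      {p | p.1 ∈ Circ ∧ ρ p.1 p.2 ≠ 0}
  hR : 1 < R
  grad_ne : ∀ z ∈ Circ, ∀ w, 0 < ρ z w → ρ z w ≤ R → fderiv ℝ (ρ z) w ≠ 0
  hypo : StrictHypoconvexOn ρ {p | p.1 ∈ Circ ∧ ρ p.1 p.2 ≠ 0}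
  levelCompact : ∀ t : ℝ, 0 < t → t ≤ R →
      IsCompact {p : ℂ × (Fin n → ℂ) | p.1 ∈ Circ ∧ ρ p.1 p.2 = t}
  fiberSphere : ∀ t : ℝ, 0 < t → t ≤ R → ∀ z ∈ Circ,
      DiffeomorphicSets {w | ρ z w = t} (Metric.sphere (0 : EuclideanSpace ℂ (Fin n)) 1)
  levelR : ∀ z ∈ Circ, ∀ w, ρ z w = R ↔ euclNorm w = R
  aboveR : ∀ z ∈ Circ, ∀ w, R < euclNorm w → R < ρ z w
  Scont : ContinuousOn S Circ
  Ssmall : ∀ z ∈ Circ, euclNorm (S z) < R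
  Szero : ∀ z ∈ Circ, ∀ w, ρ z w = 0 ↔ w = S z

/-- The `j`-th Fourier coefficient of the boundary values of `f` on the circle. -/
def bCoeff (f : ℂ → ℂ) (j : ℤ) : ℂ :=
  (1 / (2 * Real.pi) : ℂ) * ∫ θ in (0:ℝ)..(2 * Real.pi),
    f (Complex.exp (↑θ * Complex.I)) * Complex.exp (-(j : ℂ) * ↑θ * Complex.I)

/-- The Hilbert space `ℓ²(ℤ)` used to represent `W^{1,2}(Γ)`. -/
abbrev Seq2 : Type := lp (fun _ : ℤ => ℂ) 2

/-- `a ∈ ℓ²(ℤ)` is the (weighted) Fourier coefficient representation of `f` in the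
Sobolev space `W^{1,2}(Γ)`; the weight `√(1+j²)` makes the `ℓ²` norm of `a`
equivalent to the `W^{1,2}` norm of `f`. -/
def RepOf (a : Seq2) (f : ℂ → ℂ) : Prop :=
  ∀ j : ℤ, (a : ∀ _ : ℤ, ℂ) j = (Real.sqrt (1 + (j:ℝ)^2) : ℂ) * bCoeff f j

/-- Membership in `H^{1,2}(Δ) = H²(Δ) ∩ W^{1,2}(Γ)` (whose elements extend
continuously to the closed disk). -/
def MemH12 (f : ℂ → ℂ) : Prop :=
  ContinuousOn f Disk ∧ DifferentiableOn ℂ f (Metric.ball (0:ℂ) 1) ∧ ∃ a : Seq2, RepOf a f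

/-- Membership in the disk algebra `A(Δ)`. -/
def MemA (f : ℂ → ℂ) : Prop :=
  ContinuousOn f Disk ∧ DifferentiableOn ℂ f (Metric.ball (0:ℂ) 1)

/-- Membership in `H^∞(Δ)`. -/
def MemHinf (f : ℂ → ℂ) : Prop :=
  DifferentiableOn ℂ f (Metric.ball (0:ℂ) 1) ∧ ∃ M : ℝ, ∀ z ∈ Metric.ball (0:ℂ) 1, ‖f z‖ ≤ M

/-- `f` is `C^k`-smooth on the circle `Γ`. -/
def CkCirc (k : ℕ) (f : ℂ → ℂ) : Prop :=
  ContDiff ℝ k (fun θ : ℝ => f (Complex.exp (↑θ * Complex.I)))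

/-- `f` is `C⁴`-smooth on the circle `Γ`. -/
def C4Circ (f : ℂ → ℂ) : Prop := CkCirc 4 f

/-- Vector-valued versions. -/
def MemH12V {n : ℕ} (f : ℂ → Fin n → ℂ) : Prop := ∀ j, MemH12 fun z => f z j
def MemAV {n : ℕ} (f : ℂ → Fin n → ℂ) : Prop := ∀ j, MemA fun z => f z j
def MemHinfV {n : ℕ} (f : ℂ → Fin n → ℂ) : Prop := ∀ j, MemHinf fun z => f z j
def C4CircV {n : ℕ} (f : ℂ → Fin n → ℂ) : Prop := ∀ j, C4Circ fun z => f z j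

/-- The coordinates of a point of `ℂ × ℂⁿ` as a point of `ℂ^{n+1}`. -/
def pcoords {n : ℕ} (p : ℂ × (Fin n → ℂ)) : Fin (n+1) → ℂ := Fin.cons p.1 p.2

/-- The polynomial hull of a subset of `ℂ × ℂⁿ ≅ ℂ^{n+1}`. -/
def polyHull {n : ℕ} (Y : Set (ℂ × (Fin n → ℂ))) : Set (ℂ × (Fin n → ℂ)) :=
  {p | ∀ P : MvPolynomial (Fin (n+1)) ℂ, ∀ M : ℝ,
    (∀ q ∈ Y, ‖MvPolynomial.eval (pcoords q) P‖ ≤ M) → ‖MvPolynomial.eval (pcoords p) P‖ ≤ M}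

/-- The polynomial hull of a subset of `ℂⁿ`. -/
def polyHulln {n : ℕ} (Y : Set (Fin n → ℂ)) : Set (Fin n → ℂ) :=
  {w | ∀ P : MvPolynomial (Fin n) ℂ, ∀ M : ℝ,
    (∀ v ∈ Y, ‖MvPolynomial.eval v P‖ ≤ M) → ‖MvPolynomial.eval w P‖ ≤ M}

/-- The coordinates of a point of `ℂ × ℂⁿ × ℂⁿ` as a point of `ℂ^{2n+1}`. -/
def pcoords2 {n : ℕ} (p : ℂ × ((Fin n → ℂ) × (Fin n → ℂ))) : Fin (n + n + 1) → ℂ :=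
  Fin.cons p.1 (Fin.append p.2.1 p.2.2)

/-- The polynomial hull of a subset of `ℂ × ℂⁿ × ℂⁿ ≅ ℂ^{2n+1}`. -/
def polyHull2 {n : ℕ} (Y : Set (ℂ × ((Fin n → ℂ) × (Fin n → ℂ)))) :
    Set (ℂ × ((Fin n → ℂ) × (Fin n → ℂ))) :=
  {p | ∀ P : MvPolynomial (Fin (n + n + 1)) ℂ, ∀ M : ℝ,
    (∀ q ∈ Y, ‖MvPolynomial.eval (pcoords2 q) P‖ ≤ M) → ‖MvPolynomial.eval (pcoords2 p) P‖ ≤ M}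

/-- A subset of `ℂⁿ` is hypoconvex if its complement is a union of complex affine
hyperplanes. -/
def HypoconvexSet {n : ℕ} (A : Set (Fin n → ℂ)) : Prop :=
  ∀ v : Fin n → ℂ, v ∉ A → ∃ (c : Fin n → ℂ) (d : ℂ), c ≠ 0 ∧
    (∑ j, c j * v j) = d ∧ ∀ w ∈ A, (∑ j, c j * w j) ≠ d

/-- `A` has `C^k` boundary: near each boundary point the boundary is the zero set of a
`C^k` function with nonvanishing gradient. -/
def CkBoundary {E : Type*} [NormedAddCommGroup E] [NormedSpace ℝ E] (k : ℕ) (A : Set E) : Prop :=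
  ∀ p ∈ frontier A, ∃ U : Set E, IsOpen U ∧ p ∈ U ∧
    ∃ φ : E → ℝ, ContDiffOn ℝ k φ U ∧ (∀ x ∈ U, fderiv ℝ φ x ≠ 0) ∧
      frontier A ∩ U = {x | φ x = 0} ∩ U

/-- `fb` gives the a.e. radial boundary values on `Γ` of the function `f` on the open disk. -/
def IsBdryVal {n : ℕ} (f fb : ℂ → Fin n → ℂ) : Prop :=
  ∀ᵐ (θ : ℝ) ∂(volume.restrict (Set.Ioc (0:ℝ) (2 * Real.pi))),
    Filter.Tendsto (fun r : ℝ => f ((r : ℂ) * Complex.exp (↑θ * Complex.I)))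
      (nhdsWithin 1 (Set.Iio 1)) (nhds (fb (Complex.exp (↑θ * Complex.I))))

/-- The optimal control `γ_ρ = inf_{f ∈ H^∞(Δ)ⁿ} ess sup_{z ∈ Γ} ρ(z,f(z))`. -/
def gammaRho {n : ℕ} (ρ : ℂ → (Fin n → ℂ) → ℝ) : ℝ :=
  sInf {c : ℝ | ∃ f fb : ℂ → Fin n → ℂ, MemHinfV f ∧ IsBdryVal f fb ∧
    ∀ᵐ (θ : ℝ) ∂(volume.restrict (Set.Ioc (0:ℝ) (2 * Real.pi))),
      ρ (Complex.exp (↑θ * Complex.I)) (fb (Complex.exp (↑θ * Complex.I))) ≤ c}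

/-- `δ_ρ = inf_{f ∈ A(Δ)ⁿ} sup_{z ∈ Γ} ρ(z,f(z))`. -/
def deltaRho {n : ℕ} (ρ : ℂ → (Fin n → ℂ) → ℝ) : ℝ :=
  sInf {c : ℝ | ∃ f : ℂ → Fin n → ℂ, MemAV f ∧ ∀ z ∈ Circ, ρ z (f z) ≤ c}

/-- `ρ_m(z,w) = ρ(z, w/zᵐ)`. -/
def rhoShift {n : ℕ} (ρ : ℂ → (Fin n → ℂ) → ℝ) (m : ℕ) : ℂ → (Fin n → ℂ) → ℝ :=
  fun z w => ρ z (fun j => w j / z ^ m)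

/-- `q` is an `n`-tuple of harmonic polynomials. -/
def HarmPolyTuple {n : ℕ} (q : ℂ → Fin n → ℂ) : Prop :=
  ∃ (d : ℕ) (a b : ℕ → Fin n → ℂ), ∀ z : ℂ, ∀ j,
    q z j = ∑ i ∈ Finset.range (d+1), (a i j * z ^ i + b i j * (starRingEnd ℂ z) ^ i)

/-- `zᵐ q(z)` has analytic polynomial coordinates (as boundary values on `Γ`). -/
def ZmAnalytic {n : ℕ} (m : ℕ) (q : ℂ → Fin n → ℂ) : Prop :=
  ∀ j, ∃ p : Polynomial ℂ, ∀ z ∈ Circ, z ^ m * q z j = Polynomial.eval z p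

/-- The boundary function `q` on `Γ` is analytic, i.e. agrees on `Γ` with an element
of `A(Δ)ⁿ`. -/
def BoundaryAnalytic {n : ℕ} (q : ℂ → Fin n → ℂ) : Prop :=
  ∃ h : ℂ → Fin n → ℂ, MemAV h ∧ ∀ z ∈ Circ, h z = q z


/-- A regular-point property of a real function on the plane. -/
def RegPt (φ : ℂ → ℝ) (x : ℂ) : Prop :=
  ∃ ε > 0, (∀ y₁ y₂, dist y₁ x < ε → dist y₂ x < ε → φ y₁ < φ x → φ y₂ < φ x →
    JoinedIn {y | φ y < φ x} y₁ y₂) ∧ ∀ y, dist y x < ε → y ∈ closure {u | φ u < φ y}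

/-- Strict local minimum. -/
def StrMin (φ : ℂ → ℝ) (x : ℂ) : Prop :=
  ∃ ε > 0, ∀ y, y ≠ x → dist y x < ε → φ x < φ y

lemma regPt_of_strict (φ : ℂ → ℝ) (hc : Continuous φ) (x : ℂ) (L : ℂ →L[ℝ] ℝ)
    (h : HasStrictFDerivAt φ L x) (hL : L ≠ 0) : RegPt φ x := by
  obtain ⟨v₀, hv₀⟩ : ∃ v, L v ≠ 0 := by
    by_contra hh; push Not at hh; exact hL (ContinuousLinearMap.ext hh)
  obtain ⟨v, hv⟩ : ∃ v, L v = -1 := ⟨(-(L v₀)⁻¹) • v₀, by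
    rw [map_smul, smul_eq_mul]; field_simp⟩
  have hvpos : 0 < ‖v‖ := by
    rw [norm_pos_iff]; rintro rfl; simp at hv
  have h1 := (h.isLittleO.def (c := 1 / (2 * ‖v‖)) (by positivity))
  rw [Metric.eventually_nhds_iff] at h1
  obtain ⟨δ, hδ, h1⟩ := h1
  have key : ∀ y, dist y x < δ / 2 → ∀ t : ℝ, 0 ≤ t → t * ‖v‖ < δ / 2 →
      φ (y + t • v) ≤ φ y - t / 2 := by
    intro y hy t ht htv
    have hd : dist (y + t • v) x < δ := by
      have : dist (y + t • v) y = t * ‖v‖ := by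
        simp [dist_eq_norm, abs_of_nonneg ht]
      linarith [dist_triangle (y + t • v) y x]
    have := h1 (y := (y + t • v, y)) (by
      rw [Prod.dist_eq]; exact max_lt hd (by dsimp; linarith))
    simp only [add_sub_cancel_left, map_smul, hv, norm_smul, Real.norm_eq_abs, abs_of_nonneg ht,
      smul_eq_mul] at this
    have e : 1 / (2 * ‖v‖) * (t * ‖v‖) = t / 2 := by field_simp
    rw [e] at this
    have := (abs_le.1 this).2
    linarith
  set s : ℝ := δ / (4 * ‖v‖) with hs
  have hspos : 0 < s := by positivity
  have hsv : s * ‖v‖ < δ / 2 := by rw [hs]; field_simp; norm_num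
  have hxs : φ (x + s • v) < φ x := by
    have := key x (by simpa using half_pos hδ) s hspos.le hsv
    linarith
  obtain ⟨ε, hε, hball⟩ := Metric.isOpen_iff.1 (isOpen_lt hc continuous_const) (x + s • v) hxs
  refine ⟨min ε (δ / 2), by positivity, ?_, ?_⟩
  · have seg : ∀ y, dist y x < min ε (δ / 2) → φ y < φ x →
        JoinedIn {y | φ y < φ x} y (y + s • v) := by
      intro y hy hyx
      apply JoinedIn.of_segment_subset
      rintro _ ⟨a, b, ha, hb, hab, rfl⟩
      have e : a • y + b • (y + s • v) = y + (b * s) • v := by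
        rw [smul_add, ← add_assoc, ← add_smul, hab, one_smul, smul_smul]
      have hb1 : b ≤ 1 := by linarith
      rw [e]
      have h2 : b * s * ‖v‖ < δ / 2 := by
        have : b * s * ‖v‖ ≤ 1 * s * ‖v‖ := by gcongr
        linarith
      have := key y (lt_of_lt_of_le hy (min_le_right _ _)) (b * s) (by positivity) h2
      have : 0 ≤ b * s := by positivity
      show φ _ < φ x
      linarith
    intro y₁ y₂ h₁ h₂ hy₁ hy₂
    have mem : ∀ y, dist y x < min ε (δ / 2) → y + s • v ∈ ball (x + s • v) ε := by
      intro y hy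
      rw [mem_ball, dist_add_right]
      exact lt_of_lt_of_le hy (min_le_left _ _)
    have mid : JoinedIn {y | φ y < φ x} (y₁ + s • v) (y₂ + s • v) := by
      apply JoinedIn.of_segment_subset
      exact ((convex_ball _ _).segment_subset (mem _ h₁) (mem _ h₂)).trans hball
    exact ((seg _ h₁ hy₁).trans mid).trans (seg _ h₂ hy₂).symm
  · intro y hy
    rw [Metric.mem_closure_iff]
    intro η hη
    set t := min s (η / (2 * ‖v‖)) with ht
    have htpos : 0 < t := by positivity
    have h2 : t * ‖v‖ < δ / 2 :=
      lt_of_le_of_lt (mul_le_mul_of_nonneg_right (min_le_left _ _) hvpos.le) hsv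
    have h3 : t * ‖v‖ < η := by
      have : t * ‖v‖ ≤ η / (2 * ‖v‖) * ‖v‖ :=
        mul_le_mul_of_nonneg_right (min_le_right _ _) hvpos.le
      have e : η / (2 * ‖v‖) * ‖v‖ = η / 2 := by field_simp
      linarith
    refine ⟨y + t • v, ?_, ?_⟩
    · have := key y (lt_of_lt_of_le hy (min_le_right _ _)) t htpos.le h2
      show φ _ < φ y
      linarith
    · simpa [dist_eq_norm, norm_smul, abs_of_pos htpos] using h3

lemma strMin_of_hess {E : Type*} [NormedAddCommGroup E] [NormedSpace ℝ E] (f : E → ℝ) (x : E)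
    (hd : ∀ᶠ y in nhds x, DifferentiableAt ℝ f y)
    (hdd : DifferentiableAt ℝ (fderiv ℝ f) x) (K : ℝ) (hK : 0 < K) :
    ∃ ε > 0, ∀ u, u ≠ 0 → ‖u‖ < ε → fderiv ℝ f x u = 0 →
      K * ‖u‖ ^ 2 ≤ fderiv ℝ (fderiv ℝ f) x u u → f x < f (x + u) := by
  have h1 := hdd.hasFDerivAt.isLittleO.def (c := K / 2) (by positivity)
  obtain ⟨ε, hε, h⟩ := Metric.eventually_nhds_iff.1 (h1.and hd)
  refine ⟨ε, hε, fun u hu hun h0 hK2 => ?_⟩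
  have hup : 0 < ‖u‖ := norm_pos_iff.2 hu
  have near : ∀ t : ℝ, 0 ≤ t → t ≤ 1 → dist (x + t • u) x < ε := by
    intro t h0 h1
    simp only [dist_eq_norm, add_sub_cancel_left, norm_smul, Real.norm_eq_abs, abs_of_nonneg h0]
    nlinarith
  have hder : ∀ t : ℝ, 0 ≤ t → t ≤ 1 →
      HasDerivAt (fun t : ℝ => f (x + t • u)) (fderiv ℝ f (x + t • u) u) t := by
    intro t h0 h1
    have a := (h (near t h0 h1)).2.hasFDerivAt
    have b : HasDerivAt (fun t : ℝ => x + t • u) u t := by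
      simpa using ((hasDerivAt_id t).smul_const u).const_add x
    exact a.comp_hasDerivAt t b
  have mono : StrictMonoOn (fun t : ℝ => f (x + t • u)) (Icc 0 1) := by
    apply strictMonoOn_of_deriv_pos (convex_Icc 0 1)
    · intro t ht; exact (hder t ht.1 ht.2).continuousAt.continuousWithinAt
    · intro t ht
      rw [interior_Icc] at ht
      rw [(hder t ht.1.le ht.2.le).deriv]
      have e := (h (near t ht.1.le ht.2.le)).1
      simp only [add_sub_cancel_left, map_smul, norm_smul, Real.norm_eq_abs,
        abs_of_pos ht.1] at e
      have e2 := ContinuousLinearMap.le_of_opNorm_le _ e u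
      simp only [sub_apply, smul_apply, h0,
        Real.norm_eq_abs, smul_eq_mul, sub_zero] at e2
      have e3 := (abs_le.1 e2).1
      have e4 : t * (K * ‖u‖ ^ 2) ≤ t * fderiv ℝ (fderiv ℝ f) x u u := by
        exact mul_le_mul_of_nonneg_left hK2 ht.1.le
      have : 0 < t * (K * ‖u‖ ^ 2) := by have := ht.1; positivity
      nlinarith
  have := mono (left_mem_Icc.2 zero_le_one) (right_mem_Icc.2 zero_le_one) zero_lt_one
  simpa using this

lemma joinedIn_barrier (φ : ℂ → ℝ) (a b : ℂ) (c : ℝ) (δ : ℝ) (hδ : 0 < δ) (hab : δ < dist b a)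
    (hs : ∀ y, dist y a = δ → c ≤ φ y) : ¬ JoinedIn {y | φ y < c} a b := by
  rintro ⟨γ, hγ⟩
  have hcont : Continuous fun t => dist (γ t) a := by fun_prop
  have : δ ∈ range fun t => dist (γ t) a :=
    mem_range_of_exists_le_of_exists_ge hcont ⟨0, by simpa using hδ.le⟩ ⟨1, by simpa using hab.le⟩
  obtain ⟨t, ht⟩ := this
  have := hs (γ t) ht
  have h2 : φ (γ t) < c := hγ t
  linarith

lemma joinedIn_lower (φ : ℂ → ℝ) (hc : Continuous φ) (a b : ℂ) (c : ℝ)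
    (h : JoinedIn {y | φ y < c} a b) : ∃ c' < c, JoinedIn {y | φ y < c'} a b := by
  obtain ⟨γ, hγ⟩ := h
  obtain ⟨t, -, ht⟩ := isCompact_univ.exists_isMaxOn (α := ℝ) (f := fun t => φ (γ t))
    ⟨0, mem_univ _⟩ (by fun_prop)
  have hlt : φ (γ t) < c := hγ t
  obtain ⟨c', h1, h2⟩ := exists_between hlt
  exact ⟨c', h2, γ, fun s => lt_of_le_of_lt (ht (mem_univ s)) h1⟩

lemma mountain (φ : ℂ → ℝ) (hc : Continuous φ) (r R : ℝ) (h0 : φ 0 = 0)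
    (hpos : ∀ x, x ≠ 0 → 0 < φ x) (hball : ∀ x, φ x < R ↔ ‖x‖ < r)
    (hdich : ∀ x, x ≠ 0 → φ x < R → StrMin φ x ∨ RegPt φ x)
    (a : ℂ) (ha : a ≠ 0) (haR : φ a < R) : ¬ StrMin φ a := by
  rintro ⟨ε, hε, hmin⟩
  have hset : {y | φ y < R} = ball (0 : ℂ) r := by ext y; simp [hball]
  have joinR : ∀ c, R ≤ c → JoinedIn {y | φ y < c} a 0 := by
    intro c hcR
    have h1 : JoinedIn {y | φ y < R} a 0 := by
      rw [hset]
      apply JoinedIn.of_segment_subset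
      apply (convex_ball _ _).segment_subset
      · rw [← hset]; exact haR
      · rw [← hset]; show φ 0 < R; rw [h0]; linarith [hpos a ha]
    exact h1.mono fun y (hy : φ y < R) => lt_of_lt_of_le hy hcR
  set T : Set ℝ := {c | ¬ JoinedIn {y | φ y < c} a 0} with hT
  have Tlt : ∀ c ∈ T, c < R := by
    intro c hcT; by_contra hcR; exact hcT (joinR c (not_lt.1 hcR))
  -- a level slightly above `φ a` lies in `T`
  obtain ⟨c₁, hc₁m, hc₁T⟩ : ∃ c₁, φ a < c₁ ∧ c₁ ∈ T := by
    have hapos : 0 < ‖a‖ := norm_pos_iff.2 ha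
    set δ := min ε ‖a‖ / 2 with hδ
    have hmp : 0 < min ε ‖a‖ := by positivity
    have hδpos : 0 < δ := by positivity
    have hδε : δ < ε := by have := min_le_left ε ‖a‖; linarith
    have hδa : δ < ‖a‖ := by have := min_le_right ε ‖a‖; linarith
    have hne : (sphere a δ).Nonempty := NormedSpace.sphere_nonempty.2 hδpos.le
    obtain ⟨y, hy, hymin⟩ := (isCompact_sphere a δ).exists_isMinOn hne hc.continuousOn
    refine ⟨φ y, hmin y ?_ ?_, ?_⟩
    · rintro rfl; simp at hy; linarith
    · rw [mem_sphere.1 hy]; exact hδε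
    · exact joinedIn_barrier φ a 0 _ δ hδpos (by simpa using hδa) fun u hu => hymin hu
  have Tbdd : BddAbove T := ⟨R, fun c hcT => (Tlt c hcT).le⟩
  set c₀ := sSup T with hc₀
  have hc₀T : c₀ ∈ T := by
    intro hj
    obtain ⟨c', hc', hj'⟩ := joinedIn_lower φ hc a 0 c₀ hj
    obtain ⟨c, hcT, hcc⟩ := exists_lt_of_lt_csSup ⟨c₁, hc₁T⟩ hc'
    exact hcT (hj'.mono fun y (hy : φ y < c') => hy.trans hcc)
  have hc₀R : c₀ < R := Tlt _ hc₀T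
  have hac₀ : φ a < c₀ := lt_of_lt_of_le hc₁m (le_csSup Tbdd hc₁T)
  have hc₀pos : 0 < c₀ := (hpos a ha).trans hac₀
  set A : Set ℂ := {y | JoinedIn {y | φ y < c₀} a y} with hA
  have hAlt : ∀ y ∈ A, φ y < c₀ := fun y (hy : JoinedIn {y | φ y < c₀} a y) => hy.target_mem
  have hle : ∀ y ∈ closure A, φ y ≤ c₀ := by
    intro y hy
    have : closure A ⊆ {y | φ y ≤ c₀} :=
      closure_minimal (fun y hy => (hAlt y hy).le) (isClosed_le hc continuous_const)
    exact this hy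
  have hlow : ∀ x ∈ closure A, φ x < c₀ → ∃ η > 0, ball x η ⊆ A := by
    intro x hx hxc
    obtain ⟨η, hη, hb⟩ := Metric.isOpen_iff.1 (isOpen_lt hc continuous_const) x hxc
    refine ⟨η, hη, fun y hy => ?_⟩
    obtain ⟨u, huA, hu⟩ := Metric.mem_closure_iff.1 hx η hη
    have huA' : JoinedIn {y | φ y < c₀} a u := huA
    refine huA'.trans (JoinedIn.of_segment_subset ?_)
    exact ((convex_ball _ _).segment_subset (by rwa [mem_ball, dist_comm]) hy).trans hb
  have hopen : ∀ x ∈ closure A, ∃ η > 0, ∀ y, dist y x < η → φ y ≤ c₀ → y ∈ closure A := by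
    intro x hx
    rcases (hle x hx).lt_or_eq with hxc | hxc
    · obtain ⟨η, hη, hb⟩ := hlow x hx hxc
      exact ⟨η, hη, fun y hy _ => subset_closure (hb hy)⟩
    · have hx0 : x ≠ 0 := by rintro rfl; linarith
      rcases hdich x hx0 (by linarith) with ⟨η, hη, hm⟩ | ⟨η, hη, hj, hcl⟩
      · exfalso
        obtain ⟨u, huA, hu⟩ := Metric.mem_closure_iff.1 hx η hη
        have h1 := hAlt u huA
        by_cases hux : u = x
        · rw [hux] at h1; linarith
        · have := hm u hux (by rwa [dist_comm]); linarith
      · rw [hxc] at hj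
        obtain ⟨u, huA, hu⟩ := Metric.mem_closure_iff.1 hx η hη
        have huA' : JoinedIn {y | φ y < c₀} a u := huA
        have step : ∀ y, dist y x < η → φ y < c₀ → y ∈ A := fun y hy hyc =>
          huA'.trans (hj u y (by rwa [dist_comm]) hy (hAlt u huA) hyc)
        refine ⟨η, hη, fun y hy hyc => ?_⟩
        rcases hyc.lt_or_eq with hyc | hyc
        · exact subset_closure (step y hy hyc)
        · have hy2 := hcl y hy
          rw [hyc] at hy2
          rw [Metric.mem_closure_iff] at hy2 ⊢
          intro κ hκ
          obtain ⟨w, hw, hwd⟩ := hy2 (min κ (η - dist y x)) (lt_min hκ (by linarith))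
          refine ⟨w, step w ?_ hw, lt_of_lt_of_le hwd (min_le_left _ _)⟩
          have h1 := lt_of_lt_of_le hwd (min_le_right _ _)
          have h2 := dist_triangle w y x
          rw [dist_comm w y] at h2
          linarith
  have hsubset : {y | φ y ≤ c₀} ⊆ closedBall (0 : ℂ) r := by
    intro y (hy : φ y ≤ c₀)
    rw [mem_closedBall_zero_iff]
    exact ((hball y).1 (by linarith)).le
  have hcompS : IsCompact {y | φ y ≤ c₀} :=
    (isCompact_closedBall (0 : ℂ) r).of_isClosed_subset (isClosed_le hc continuous_const) hsubset
  have hK1 : IsCompact (closure A) := hcompS.of_isClosed_subset isClosed_closure hle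
  set K2 : Set ℂ := {y | φ y ≤ c₀} \ closure A with hK2d
  have hK2cl : IsClosed K2 := by
    rw [← closure_subset_iff_isClosed]
    intro y hy
    have hyc : φ y ≤ c₀ := closure_minimal (fun u hu => hu.1)
      (isClosed_le hc continuous_const) hy
    refine ⟨hyc, fun hyA => ?_⟩
    obtain ⟨η, hη, h⟩ := hopen y hyA
    obtain ⟨u, hu, hud⟩ := Metric.mem_closure_iff.1 hy η hη
    exact hu.2 (h u (by rwa [dist_comm]) hu.1)
  have hK2 : IsCompact K2 := hcompS.of_isClosed_subset hK2cl sdiff_subset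
  have h0K2 : (0 : ℂ) ∈ K2 := by
    refine ⟨by show φ 0 ≤ c₀; linarith, fun h => ?_⟩
    obtain ⟨η, hη, hb⟩ := hlow 0 h (by linarith)
    exact hc₀T (hb (mem_ball_self hη))
  have haK1 : a ∈ closure A := subset_closure (JoinedIn.refl hac₀)
  obtain ⟨U, W, hU, hW, hKU, hKW, hUW⟩ :=
    SeparatedNhds.of_isCompact_isCompact hK1 hK2 disjoint_sdiff_right
  have hcov : ∀ y, φ y ≤ c₀ → y ∈ U ∪ W := by
    intro y hy
    by_cases h : y ∈ closure A
    · exact Or.inl (hKU h)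
    · exact Or.inr (hKW ⟨hy, h⟩)
  obtain ⟨c, hcc₀, hcR, hcU⟩ : ∃ c, c₀ < c ∧ c ≤ R ∧ ∀ y, φ y < c → y ∈ U ∪ W := by
    have hcomp : IsCompact (closedBall (0 : ℂ) r \ (U ∪ W)) :=
      (isCompact_closedBall _ _).diff (hU.union hW)
    rcases (closedBall (0 : ℂ) r \ (U ∪ W)).eq_empty_or_nonempty with he | hne
    · refine ⟨R, hc₀R, le_rfl, fun y hy => ?_⟩
      by_contra hyU
      have : y ∈ closedBall (0 : ℂ) r \ (U ∪ W) :=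
        ⟨by rw [mem_closedBall_zero_iff]; exact ((hball y).1 hy).le, hyU⟩
      rw [he] at this; exact this
    · obtain ⟨y, hy, hym⟩ := hcomp.exists_isMinOn hne hc.continuousOn
      refine ⟨min R (φ y), lt_min hc₀R ?_, min_le_left _ _, fun u hu => ?_⟩
      · by_contra hh; exact hy.2 (hcov y (not_lt.1 hh))
      · by_contra huU
        have hu1 := lt_of_lt_of_le hu (min_le_left _ _)
        have hu2 := lt_of_lt_of_le hu (min_le_right _ _)
        have : φ y ≤ φ u := hym
          ⟨by rw [mem_closedBall_zero_iff]; exact ((hball u).1 hu1).le, huU⟩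
        linarith
  have hj : JoinedIn {y | φ y < c} a 0 := by
    by_contra hn
    have := le_csSup Tbdd (show c ∈ T from hn)
    linarith
  obtain ⟨γ, hγ⟩ := hj
  have hpre : IsPreconnected (range γ) := isPreconnected_range γ.continuous
  rcases hpre.subset_or_subset hU hW hUW (by
      rintro _ ⟨t, rfl⟩; exact hcU _ (hγ t)) with h | h
  · have h1 : (0 : ℂ) ∈ U := h ⟨1, by simp⟩
    exact hUW.le_bot ⟨h1, hKW h0K2⟩
  · have h1 : a ∈ W := h ⟨0, by simp⟩
    exact hUW.le_bot ⟨hKU haK1, h1⟩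

lemma euclNorm_nonneg {n : ℕ} (w : Fin n → ℂ) : 0 ≤ euclNorm w := Real.sqrt_nonneg _

lemma euclNorm_smul {n : ℕ} (c : ℂ) (w : Fin n → ℂ) : euclNorm (c • w) = ‖c‖ * euclNorm w := by
  unfold euclNorm
  simp only [Pi.smul_apply, smul_eq_mul, Complex.normSq_mul, ← Finset.mul_sum]
  rw [Real.sqrt_mul (Complex.normSq_nonneg _)]
  rfl

lemma norm_le_euclNorm {n : ℕ} (w : Fin n → ℂ) : ‖w‖ ≤ euclNorm w := by
  rw [pi_norm_le_iff_of_nonneg (euclNorm_nonneg w)]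
  intro i
  apply Real.le_sqrt_of_sq_le
  rw [← Complex.normSq_eq_norm_sq]
  exact Finset.single_le_sum (f := fun j => Complex.normSq (w j))
    (fun j _ => Complex.normSq_nonneg _) (Finset.mem_univ i)

lemma euclNorm_pos {n : ℕ} {w : Fin n → ℂ} (h : w ≠ 0) : 0 < euclNorm w :=
  lt_of_lt_of_le (norm_pos_iff.2 h) (norm_le_euclNorm w)

lemma euclNorm_zero {n : ℕ} : euclNorm (0 : Fin n → ℂ) = 0 := by simp [euclNorm]

lemma continuous_euclNorm {n : ℕ} : Continuous (euclNorm (n := n)) := by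
  unfold euclNorm
  have : Continuous Complex.normSq := Complex.continuous_normSq
  fun_prop

lemma fderiv_eq_wderiv {n : ℕ} (g : (Fin n → ℂ) → ℝ) (w u : Fin n → ℂ) :
    fderiv ℝ g w u = 2 * (∑ j, u j * wderiv g w j).re := by
  set L := fderiv ℝ g w with hL
  have hu : u = ∑ j, ((u j).re • (Pi.single j (1 : ℂ) : Fin n → ℂ)
      + (u j).im • (Pi.single j Complex.I : Fin n → ℂ)) := by
    have : ∀ j, ((u j).re • (Pi.single j (1 : ℂ) : Fin n → ℂ)
      + (u j).im • (Pi.single j Complex.I : Fin n → ℂ)) = Pi.single j (u j) := by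
      intro j
      rw [← Pi.single_smul, ← Pi.single_smul, ← Pi.single_add]
      congr 1
      simp [Complex.re_add_im]
    simp only [this]
    exact (Finset.univ_sum_single u).symm
  conv_lhs => rw [hu]
  rw [map_sum, Complex.re_sum, Finset.mul_sum]
  refine Finset.sum_congr rfl fun j _ => ?_
  rw [map_add, map_smul, map_smul]
  simp only [wderiv, ← hL, smul_eq_mul]
  generalize L (Pi.single j 1) = A
  generalize L (Pi.single j I) = B
  have : ((A : ℂ) - I * B) / 2 = ⟨A / 2, -B / 2⟩ := by
    apply Complex.ext <;> simp
  rw [this, Complex.mul_re]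
  ring

section rho
variable {n : ℕ} {ρ : ℂ → (Fin n → ℂ) → ℝ} {R : ℝ}

lemma rho_cont (hρ : Cond3 n ρ R (fun _ => 0)) {z : ℂ} (hz : z ∈ Circ) : Continuous (ρ z) := by
  have := hρ.cont.comp_continuous (f := fun w : Fin n → ℂ => (z, w)) (by fun_prop) (fun _ => hz)
  exact this

lemma rho_ne (hρ : Cond3 n ρ R (fun _ => 0)) {z : ℂ} (hz : z ∈ Circ) {w : Fin n → ℂ}
    (hw : w ≠ 0) : ρ z w ≠ 0 := fun h => hw ((hρ.Szero z hz w).1 h)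

lemma exp_mem_circ (θ : ℝ) : Complex.exp (↑θ * Complex.I) ∈ Circ := by
  simp [Circ, Complex.norm_exp_ofReal_mul_I]

lemma exists_exp {z : ℂ} (hz : z ∈ Circ) : ∃ θ : ℝ, z = Complex.exp (↑θ * Complex.I) := by
  refine ⟨Complex.arg z, ?_⟩
  have h := Complex.norm_mul_exp_arg_mul_I z
  have h1 : ‖z‖ = 1 := by simpa [Circ] using hz
  rw [h1] at h
  simpa using h.symm

lemma psi_smooth (hρ : Cond3 n ρ R (fun _ => 0)) :
    ContDiffOn ℝ 6 (fun p : ℝ × (Fin n → ℂ) => ρ (Complex.exp (↑p.1 * Complex.I)) p.2)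
      {p | p.2 ≠ 0} := by
  have h1 : ContDiff ℝ 6 (fun p : ℝ × (Fin n → ℂ) => (Complex.exp (↑p.1 * Complex.I), p.2)) := by
    have : ContDiff ℝ 6 (fun x : ℝ => (x : ℂ)) := Complex.ofRealCLM.contDiff
    fun_prop
  exact hρ.smooth.comp h1.contDiffOn fun p hp => ⟨exp_mem_circ _, rho_ne hρ (exp_mem_circ _) hp⟩

lemma open_ne : IsOpen {p : ℝ × (Fin n → ℂ) | p.2 ≠ 0} :=
  isOpen_ne_fun continuous_snd continuous_const

lemma rho_contDiffAt (hρ : Cond3 n ρ R (fun _ => 0)) {z : ℂ} (hz : z ∈ Circ) {w : Fin n → ℂ}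
    (hw : w ≠ 0) : ContDiffAt ℝ 6 (ρ z) w := by
  obtain ⟨θ, rfl⟩ := exists_exp hz
  have h := (psi_smooth hρ).contDiffAt (x := (θ, w)) (open_ne.mem_nhds hw)
  have h2 : ContDiffAt ℝ 6 (fun w : Fin n → ℂ => (θ, w)) w := by fun_prop
  exact h.comp w h2

lemma wderiv_cont (hρ : Cond3 n ρ R (fun _ => 0)) (j : Fin n) :
    ContinuousOn (fun p : ℝ × (Fin n → ℂ) =>
      wderiv (ρ (Complex.exp (↑p.1 * Complex.I))) p.2 j) {p | p.2 ≠ 0} := by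
  set ψ := (fun p : ℝ × (Fin n → ℂ) => ρ (Complex.exp (↑p.1 * Complex.I)) p.2) with hψ
  have hc : ContinuousOn (fderiv ℝ ψ) {p | p.2 ≠ 0} :=
    (psi_smooth hρ).continuousOn_fderiv_of_isOpen open_ne (by norm_num)
  have he : ∀ p : ℝ × (Fin n → ℂ), p.2 ≠ 0 → ∀ u,
      fderiv ℝ (ρ (Complex.exp (↑p.1 * Complex.I))) p.2 u = fderiv ℝ ψ p (0, u) := by
    rintro ⟨θ, w⟩ hw u
    have h := ((psi_smooth hρ).contDiffAt (x := (θ, w)) (open_ne.mem_nhds hw)).differentiableAt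
      (by norm_num)
    have h2 : HasFDerivAt (fun w : Fin n → ℂ => (θ, w))
      (ContinuousLinearMap.inr ℝ ℝ (Fin n → ℂ)) w := hasFDerivAt_prodMk_right θ w
    have h3 := (h.hasFDerivAt.comp w h2).fderiv
    have h4 : fderiv ℝ (ρ (Complex.exp (↑θ * Complex.I))) w =
      (fderiv ℝ ψ (θ, w)).comp (ContinuousLinearMap.inr ℝ ℝ (Fin n → ℂ)) := h3
    show fderiv ℝ (ρ (Complex.exp (↑θ * Complex.I))) w u = _
    rw [h4]; rfl
  have hcu : ∀ u : Fin n → ℂ, ContinuousOn (fun p : ℝ × (Fin n → ℂ) =>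
      ((fderiv ℝ (ρ (Complex.exp (↑p.1 * Complex.I))) p.2 u : ℝ) : ℂ)) {p | p.2 ≠ 0} := by
    intro u
    apply Complex.continuous_ofReal.comp_continuousOn
    exact (hc.clm_apply continuousOn_const).congr fun p hp => he p hp u
  unfold wderiv
  exact ((hcu _).sub (continuousOn_const.mul (hcu _))).div_const 2

lemma lt_iff (hρ : Cond3 n ρ R (fun _ => 0)) {z : ℂ} (hz : z ∈ Circ) (w : Fin n → ℂ) :
    ρ z w < R ↔ euclNorm w < R := by
  constructor
  · intro h
    rcases lt_trichotomy (euclNorm w) R with h1 | h1 | h1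
    · exact h1
    · have := (hρ.levelR z hz w).2 h1; linarith
    · have := hρ.aboveR z hz w h1; linarith
  · intro h
    by_contra hn
    have hR0 : 0 < R := by linarith [hρ.hR]
    have hcont : Continuous fun t : ℝ => ρ z ((t : ℂ) • w) :=
      (rho_cont hρ hz).comp (by fun_prop)
    have hz0 : ρ z 0 = 0 := (hρ.Szero z hz 0).2 rfl
    have := intermediate_value_Icc (zero_le_one (α := ℝ)) hcont.continuousOn
    obtain ⟨t, ht, hte⟩ := this (show R ∈ _ from ⟨by simp [hz0, hR0.le], by simpa using hn⟩)
    have h2 := (hρ.levelR z hz _).1 hte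
    rw [euclNorm_smul, Complex.norm_real, Real.norm_eq_abs, abs_of_nonneg ht.1] at h2
    nlinarith [ht.1, ht.2, euclNorm_nonneg w]

lemma sum_smul_wderiv (g : (Fin n → ℂ) → ℝ) (w p : Fin n → ℂ) (ζ : ℂ) :
    ∑ j, (ζ • p) j * wderiv g w j = ζ * ∑ j, p j * wderiv g w j := by
  rw [Finset.mul_sum]
  exact Finset.sum_congr rfl fun j _ => by simp [mul_assoc]

lemma crit_strMin (hρ : Cond3 n ρ R (fun _ => 0)) {z : ℂ} (hz : z ∈ Circ) {p : Fin n → ℂ}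
    (hp : p ≠ 0) {x : ℂ} (hx : x ≠ 0) (hS : ∑ j, p j * wderiv (ρ z) (x • p) j = 0) :
    StrMin (fun ζ => ρ z (ζ • p)) x := by
  have hw : x • p ≠ 0 := smul_ne_zero hx hp
  obtain ⟨K, hK, hKK⟩ := hρ.hypo {(z, x • p)} (by
    rintro _ rfl; exact ⟨hz, rho_ne hρ hz hw⟩) isCompact_singleton
  have hsm := rho_contDiffAt hρ hz hw
  have hd : ∀ᶠ y in nhds (x • p), DifferentiableAt ℝ (ρ z) y := by
    filter_upwards [isOpen_ne.mem_nhds hw] with y hy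
    exact (rho_contDiffAt hρ hz hy).differentiableAt (by norm_num)
  have hdd : DifferentiableAt ℝ (fderiv ℝ (ρ z)) (x • p) :=
    (hsm.fderiv_right (m := 1) (by norm_num)).differentiableAt (by norm_num)
  obtain ⟨ε, hε, h⟩ := strMin_of_hess (ρ z) (x • p) hd hdd K hK
  have hpn : 0 < ‖p‖ := norm_pos_iff.2 hp
  refine ⟨ε / ‖p‖, by positivity, fun y hy hyd => ?_⟩
  have hz0 : ∑ j, ((y - x) • p) j * wderiv (ρ z) (x • p) j = 0 := by
    rw [sum_smul_wderiv, hS, mul_zero]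
  have := h ((y - x) • p) (smul_ne_zero (sub_ne_zero.2 hy) hp) ?_ ?_ ?_
  · have e : x • p + (y - x) • p = y • p := by rw [← add_smul]; simp
    rwa [e] at this
  · rw [norm_smul, ← dist_eq_norm]
    exact (lt_div_iff₀ hpn).1 hyd
  · rw [fderiv_eq_wderiv, hz0]; simp
  · have h1 := hKK _ rfl ((y - x) • p) hz0
    rw [iteratedFDeriv_two_apply] at h1
    refine le_trans ?_ h1
    gcongr
    exact norm_le_euclNorm _

lemma H_ne (hρ : Cond3 n ρ R (fun _ => 0)) {z : ℂ} (hz : z ∈ Circ) {p : Fin n → ℂ}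
    (hp : p ≠ 0) (hpR : euclNorm p ≤ R) : ∑ j, p j * wderiv (ρ z) p j ≠ 0 := by
  intro hS
  have hmin : StrMin (fun ζ => ρ z (ζ • p)) 1 :=
    crit_strMin hρ hz hp one_ne_zero (by simpa using hS)
  have hpn := euclNorm_pos hp
  rcases hpR.lt_or_eq with hlt | heq
  · refine mountain (fun ζ => ρ z (ζ • p)) ((rho_cont hρ hz).comp (by fun_prop))
      (R / euclNorm p) R ?_ ?_ ?_ ?_ 1 one_ne_zero ?_ hmin
    · simpa using (hρ.Szero z hz 0).2 rfl
    · intro x hx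
      exact lt_of_le_of_ne (hρ.nonneg z hz _) (rho_ne hρ hz (smul_ne_zero hx hp)).symm
    · intro x
      rw [lt_iff hρ hz, euclNorm_smul, lt_div_iff₀ hpn]
    · intro x hx _
      by_cases hSx : ∑ j, p j * wderiv (ρ z) (x • p) j = 0
      · exact Or.inl (crit_strMin hρ hz hp hx hSx)
      · right
        have hst := (rho_contDiffAt hρ hz (smul_ne_zero hx hp)).hasStrictFDerivAt (by norm_num)
        set A : ℂ →L[ℝ] (Fin n → ℂ) := (ContinuousLinearMap.id ℝ ℂ).smulRight p with hA
        have hcomp := hst.comp x A.hasStrictFDerivAt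
        refine regPt_of_strict _ ((rho_cont hρ hz).comp (by fun_prop)) x _ hcomp ?_
        intro h0
        have h1 := congrArg (fun L : ℂ →L[ℝ] ℝ =>
          L (starRingEnd ℂ (∑ j, p j * wderiv (ρ z) (x • p) j))) h0
        have h2 : fderiv ℝ (ρ z) (x • p)
          ((starRingEnd ℂ (∑ j, p j * wderiv (ρ z) (x • p) j)) • p) = 0 := h1
        rw [fderiv_eq_wderiv, sum_smul_wderiv, ← Complex.normSq_eq_conj_mul_self,
          Complex.ofReal_re] at h2
        have := Complex.normSq_pos.2 hSx
        linarith
    · simpa using (lt_iff hρ hz p).2 hlt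
  · obtain ⟨ε, hε, h⟩ := hmin
    set t : ℝ := 1 - min ε 1 / 2 with ht
    have hm : 0 < min ε 1 := by positivity
    have hm1 := min_le_right ε 1
    have hm2 := min_le_left ε 1
    have h1 := h (t : ℂ) (by
      intro h; have : t = 1 := by exact_mod_cast h
      linarith) (by
      rw [dist_eq_norm, ← Complex.ofReal_one, ← Complex.ofReal_sub, Complex.norm_real,
        Real.norm_eq_abs, abs_lt]
      constructor <;> linarith)
    have h2 : ρ z ((t : ℂ) • p) < R := by
      rw [lt_iff hρ hz, euclNorm_smul, Complex.norm_real, Real.norm_eq_abs,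
        abs_of_pos (by linarith), heq]
      have : 0 < R := by linarith [hρ.hR]
      nlinarith
    have h3 := (hρ.levelR z hz p).2 heq
    simp only [one_smul] at h1
    linarith

lemma H_pos (hρ : Cond3 n ρ R (fun _ => 0)) {z : ℂ} (hz : z ∈ Circ) {p : Fin n → ℂ}
    (hpR : euclNorm p = R) : ∃ s : ℝ, 0 < s ∧ ∑ j, p j * wderiv (ρ z) p j = (s : ℂ) := by
  have hR0 : 0 < R := by linarith [hρ.hR]
  have hp : p ≠ 0 := by rintro rfl; rw [euclNorm_zero] at hpR; linarith
  set S := ∑ j, p j * wderiv (ρ z) p j with hS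
  have hne : S ≠ 0 := H_ne hρ hz hp hpR.le
  have hder := ((rho_contDiffAt hρ hz hp).differentiableAt (by norm_num)).hasFDerivAt
  have him : S.im = 0 := by
    have hc : HasDerivAt (fun t : ℝ => Complex.exp (t * I) • p) (I • p) 0 := by
      have h1 : HasDerivAt (fun t : ℝ => Complex.exp (t * I)) I 0 := by
        have h2 : HasDerivAt (fun t : ℝ => (t : ℂ) * I) I 0 := by
          simpa using (Complex.ofRealCLM.hasDerivAt (x := (0 : ℝ))).mul_const I
        simpa using h2.cexp
      exact h1.smul_const p
    have h0 : Complex.exp (((0 : ℝ) : ℂ) * I) • p = p := by simp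
    have h3 : HasDerivAt (fun t : ℝ => ρ z (Complex.exp (t * I) • p))
        (fderiv ℝ (ρ z) p (I • p)) 0 := by
      apply HasFDerivAt.comp_hasDerivAt (0 : ℝ) _ hc
      rw [h0]; exact hder
    have h4 : (fun t : ℝ => ρ z (Complex.exp (t * I) • p)) = fun _ => R := by
      funext t
      rw [hρ.levelR z hz, euclNorm_smul, Complex.norm_exp_ofReal_mul_I, one_mul, hpR]
    rw [h4] at h3
    have h5 := h3.unique (hasDerivAt_const _ _)
    rw [fderiv_eq_wderiv, sum_smul_wderiv, ← hS] at h5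
    simpa using h5
  have hre : 0 ≤ S.re := by
    have hc : HasDerivAt (fun t : ℝ => (t : ℂ) • p) p 1 := by
      have h1 : HasDerivAt (fun t : ℝ => (t : ℂ)) 1 1 := by
        exact (hasDerivAt_id (1 : ℝ)).ofReal_comp
      simpa using h1.smul_const p
    have h3 : HasDerivAt (fun t : ℝ => ρ z ((t : ℂ) • p)) (fderiv ℝ (ρ z) p p) 1 := by
      apply HasFDerivAt.comp_hasDerivAt (1 : ℝ) _ hc
      simpa using hder
    have h4 : 0 ≤ fderiv ℝ (ρ z) p p := by
      have h5 := (hasDerivAt_iff_tendsto_slope.1 h3).mono_left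
        (nhdsWithin_mono (1 : ℝ) (show Iio (1 : ℝ) ⊆ {1}ᶜ from fun t ht => ne_of_lt ht))
      refine ge_of_tendsto h5 ?_
      filter_upwards [Ioo_mem_nhdsLT (show (0 : ℝ) < 1 by norm_num)] with t ht
      have h6 : ρ z ((t : ℂ) • p) < R := by
        rw [lt_iff hρ hz, euclNorm_smul, Complex.norm_real, Real.norm_eq_abs,
          abs_of_pos ht.1, hpR]
        nlinarith [ht.2]
      have h7 := (hρ.levelR z hz p).2 hpR
      rw [slope_def_field]
      apply div_nonneg_of_nonpos
      · simp only [Complex.ofReal_one, one_smul]; linarith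
      · linarith [ht.2]
    rw [fderiv_eq_wderiv, ← hS] at h4
    linarith
  have heq : S = (S.re : ℂ) := by
    apply Complex.ext <;> simp [him]
  refine ⟨S.re, lt_of_le_of_ne hre ?_, heq⟩
  intro h
  apply hne
  rw [heq, ← h]; simp

end rho

lemma lift_lemma (F : unitInterval × ℝ → ℂ) (hF : Continuous F) (hne : ∀ q, F q ≠ 0)
    (hper : ∀ t θ, F (t, θ + 2 * Real.pi) = F (t, θ))
    (h0 : ∀ θ, ∃ s : ℝ, 0 < s ∧ F (0, θ) = s) :
    ∃ l : ℝ → ℂ, Continuous l ∧ (∀ θ : ℝ, l (θ + 2 * Real.pi) = l θ) ∧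
      ∀ θ, F (1, θ) = Complex.exp (l θ) := by
  have cov := Complex.isCoveringMap_exp
  set Hm : C(unitInterval × ℝ, {z : ℂ // z ≠ 0}) :=
    ⟨fun q => ⟨F q, hne q⟩, by fun_prop⟩ with hHm
  have hcont : Continuous fun θ : ℝ => ((Real.log (F (0, θ)).re : ℝ) : ℂ) := by
    refine Complex.continuous_ofReal.comp (Continuous.log (by fun_prop) fun θ => ?_)
    obtain ⟨s, hs, he⟩ := h0 θ
    rw [he]; simpa using hs.ne'
  set f0 : C(ℝ, ℂ) := ⟨_, hcont⟩ with hf0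
  have H0 : ∀ θ, Hm (0, θ) = (⟨_, (f0 θ).exp_ne_zero⟩ : {z : ℂ // z ≠ 0}) := by
    intro θ
    apply Subtype.ext
    show F (0, θ) = Complex.exp ((Real.log (F (0, θ)).re : ℝ) : ℂ)
    obtain ⟨s, hs, he⟩ := h0 θ
    rw [he, Complex.ofReal_re, ← Complex.ofReal_exp, Real.exp_log hs]
  have hl := cov.liftHomotopy_lifts Hm f0 H0
  have hz := cov.liftHomotopy_zero Hm f0 H0
  set G := cov.liftHomotopy Hm f0 H0 with hG
  have hGe : ∀ q, Complex.exp (G q) = F q := fun q => congrArg Subtype.val (congrFun hl q)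
  have hGp : (fun q : unitInterval × ℝ => G (q.1, q.2 + 2 * Real.pi)) = G := by
    rw [hG, cov.eq_liftHomotopy_iff]
    refine ⟨fun a => by fun_prop, ?_, fun a => ?_⟩
    · funext q
      apply Subtype.ext
      show Complex.exp (G (q.1, q.2 + 2 * Real.pi)) = F q
      rw [hGe, hper]
    · show G (0, a + 2 * Real.pi) = f0 a
      rw [hz]
      show ((Real.log (F (0, a + 2 * Real.pi)).re : ℝ) : ℂ) = ((Real.log (F (0, a)).re : ℝ) : ℂ)
      rw [hper]
  exact ⟨fun θ => G (1, θ), by fun_prop, fun θ => congrFun hGp (1, θ), fun θ => (hGe _).symm⟩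

/-- under the hypotheses of Theorem 1, `z ↦ Σⱼ fⱼ(z)∂ρ/∂wⱼ(z,f(z))` is
nonvanishing on `Γ` with winding number zero. -/
theorem statement18 {n : ℕ} (ρ : ℂ → (Fin n → ℂ) → ℝ) (R : ℝ)
    (hρ : Cond3 n ρ R (fun _ => 0))
    (f g : ℂ → Fin n → ℂ)
    (hf12 : MemH12V f) (hg12 : MemH12V g)
    (hf4 : C4CircV f) (hg4 : C4CircV g)
    (hρf : ∀ z ∈ Circ, ρ z (f z) = 1)
    (hfg : ∀ z ∈ Circ, ∑ j, f z j * g z j = 1)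
    (htan : ∀ z ∈ Circ, {w : Fin n → ℂ | ∑ j, g z j * w j = 1} = TangentPlane (ρ z) (f z)) :
    (∀ z ∈ Circ, (∑ j, f z j * wderiv (ρ z) (f z) j) ≠ 0) ∧
    ∃ l : ℝ → ℂ, Continuous l ∧ (∀ θ : ℝ, l (θ + 2 * Real.pi) = l θ) ∧
      ∀ θ : ℝ,
        (∑ j, f (Complex.exp (↑θ * Complex.I)) j *
          wderiv (ρ (Complex.exp (↑θ * Complex.I))) (f (Complex.exp (↑θ * Complex.I))) j)
        = Complex.exp (l θ) := by
  have hf0 : ∀ z ∈ Circ, f z ≠ 0 := by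
    intro z hz h
    have h1 := (hρ.Szero z hz (f z)).2 h
    rw [hρf z hz] at h1
    exact one_ne_zero h1
  have hfR : ∀ z ∈ Circ, euclNorm (f z) < R := fun z hz =>
    (lt_iff hρ hz _).1 (by rw [hρf z hz]; exact hρ.hR)
  refine ⟨fun z hz => H_ne hρ hz (hf0 z hz) (hfR z hz).le, ?_⟩
  have hR0 : 0 < R := by linarith [hρ.hR]
  set F0 : ℝ → Fin n → ℂ := fun θ => f (Complex.exp (↑θ * Complex.I)) with hF0
  have hF0c : Continuous F0 := continuous_pi fun j => by
    have h : ContDiff ℝ (4 : ℕ) (fun θ : ℝ => f (Complex.exp (↑θ * Complex.I)) j) := hf4 j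
    exact h.continuous
  have hF0ne : ∀ θ, F0 θ ≠ 0 := fun θ => hf0 _ (exp_mem_circ θ)
  have hF0R : ∀ θ, euclNorm (F0 θ) < R := fun θ => hfR _ (exp_mem_circ θ)
  have hexp : ∀ θ : ℝ, Complex.exp (↑(θ + 2 * Real.pi) * Complex.I)
      = Complex.exp (↑θ * Complex.I) := by
    intro θ
    push_cast
    rw [add_mul, Complex.exp_periodic]
  set m : unitInterval × ℝ → ℝ :=
    fun q => (1 - (q.1 : ℝ)) * (R / euclNorm (F0 q.2)) + q.1 with hm
  have hmc : Continuous m := by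
    have : Continuous fun q : unitInterval × ℝ => R / euclNorm (F0 q.2) :=
      continuous_const.div (continuous_euclNorm.comp (hF0c.comp continuous_snd))
        fun q => (euclNorm_pos (hF0ne q.2)).ne'
    fun_prop
  have hmge : ∀ q, 1 ≤ m q := by
    intro q
    have h1 : 1 ≤ R / euclNorm (F0 q.2) := by
      rw [le_div_iff₀ (euclNorm_pos (hF0ne _))]; linarith [hF0R q.2]
    have h2 := q.1.2.2
    simp only [hm]
    nlinarith
  have hmn : ∀ q, euclNorm ((m q : ℂ) • F0 q.2) =
      (1 - (q.1 : ℝ)) * R + q.1 * euclNorm (F0 q.2) := by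
    intro q
    have h3 := euclNorm_pos (hF0ne q.2)
    rw [euclNorm_smul, Complex.norm_real, Real.norm_eq_abs,
      abs_of_pos (by linarith [hmge q])]
    simp only [hm]
    field_simp
  have hwne : ∀ q, (m q : ℂ) • F0 q.2 ≠ 0 := fun q =>
    smul_ne_zero (by exact_mod_cast (zero_lt_one.trans_le (hmge q)).ne') (hF0ne _)
  have hw : Continuous fun q : unitInterval × ℝ => (m q : ℂ) • F0 q.2 :=
    (Complex.continuous_ofReal.comp hmc).smul (hF0c.comp continuous_snd)
  set F : unitInterval × ℝ → ℂ := fun q => ∑ j, ((m q : ℂ) • F0 q.2) j *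
      wderiv (ρ (Complex.exp (↑q.2 * Complex.I))) ((m q : ℂ) • F0 q.2) j with hF
  have k1 : Continuous F := by
    refine continuous_finsetSum _ fun j _ => ?_
    refine ((continuous_apply j).comp hw).mul ?_
    exact (wderiv_cont hρ j).comp_continuous
      (f := fun q : unitInterval × ℝ => (q.2, (m q : ℂ) • F0 q.2))
      (continuous_snd.prodMk hw) (fun q => hwne q)
  have k2 : ∀ q, F q ≠ 0 := by
    intro q
    refine H_ne hρ (exp_mem_circ _) (hwne q) ?_
    rw [hmn]
    have h2 := q.1.2.1
    nlinarith [hF0R q.2]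
  have k3 : ∀ t θ, F (t, θ + 2 * Real.pi) = F (t, θ) := by
    intro t θ
    simp only [hF, hm, hF0, hexp]
  have k4 : ∀ θ, ∃ s : ℝ, 0 < s ∧ F (0, θ) = s := by
    intro θ
    refine H_pos hρ (exp_mem_circ _) ?_
    rw [hmn]; simp
  obtain ⟨l, hl1, hl2, hl3⟩ := lift_lemma F k1 k2 k3 k4
  refine ⟨l, hl1, hl2, fun θ => ?_⟩
  rw [← hl3 θ]
  simp [hF, hm, hF0]
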